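/- The edges of the graph of regular Markov numbers are given by the Markov recurrences: if the triple of sequences (α,γ,β) is reachable from the root ((1,1),(1,1,2,2),(2,2)) by a finite sequence of the moves L and R, and (x, M, y) = (K̆(α), K̆(γ), K̆(β)), then χ(L(α,γ,β)) = (x, 3Mx − y, M) and χ(R(α,γ,β)) = (M, 3My − x, y). -/

import Mathlib

/-- The continuant `K(a₁,…,aₖ)` of a finite sequence of integers. -/
def continuant : List ℤ → ℤ
  | [] => 1
  | [a] => a
  | a :: b :: t => a * continuant (b :: t) + continuant t

/-- The integer sine `K̆(α)`: the continuant of `α` with its last entry removed. -/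
def intSine (l : List ℤ) : ℤ := continuant l.dropLast

abbrev Triple := List ℤ × List ℤ × List ℤ

/-- The move `L(α,γ,β) = (α, α⊕γ, γ)`. -/
def Lmove (v : Triple) : Triple := (v.1, v.1 ++ v.2.1, v.2.1)

/-- The move `R(α,γ,β) = (γ, γ⊕β, β)`. -/
def Rmove (v : Triple) : Triple := (v.2.1, v.2.1 ++ v.2.2, v.2.2)

/-- One edge step in the binary graph. -/
def GStep (v w : Triple) : Prop := w = Lmove v ∨ w = Rmove v

/-- Reachability by a finite sequence of moves `L` and `R`. -/
def Reach : Triple → Triple → Prop := Relation.ReflTransGen GStep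

/-- `χ(α,γ,β) = (K̆ α, K̆ γ, K̆ β)`. -/
def chi (v : Triple) : ℤ × ℤ × ℤ := (intSine v.1, intSine v.2.1, intSine v.2.2)

/-- The root `((1,1), (1,1,2,2), (2,2))` of the regular Markov graph. -/
def markovRoot : Triple := ([1, 1], [1, 1] ++ [2, 2], [2, 2])

/-- The product of the matrices `!![a, 1; 1, 0]` over the entries `a` of a sequence. -/
def continuantMatrix (l : List ℤ) : Matrix (Fin 2) (Fin 2) ℤ :=
  (l.map fun a => !![a, 1; 1, 0]).prod

theorem continuantMatrix_cons (a : ℤ) (l : List ℤ) :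
    continuantMatrix (a :: l) = !![a, 1; 1, 0] * continuantMatrix l := by
  simp [continuantMatrix]

theorem continuantMatrix_append (l m : List ℤ) :
    continuantMatrix (l ++ m) = continuantMatrix l * continuantMatrix m := by
  simp [continuantMatrix]

theorem continuantMatrix_cons_zero (a : ℤ) (l : List ℤ) (j : Fin 2) :
    continuantMatrix (a :: l) 0 j = a * continuantMatrix l 0 j + continuantMatrix l 1 j := by
  simp [continuantMatrix_cons, Matrix.mul_apply]

theorem continuantMatrix_cons_one (a : ℤ) (l : List ℤ) (j : Fin 2) :
    continuantMatrix (a :: l) 1 j = continuantMatrix l 0 j := by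
  simp [continuantMatrix_cons, Matrix.mul_apply]

theorem intSine_eq_continuantMatrix {l : List ℤ} (hl : l ≠ []) :
    intSine l = continuantMatrix l 0 1 := by
  match l with
  | [] => exact absurd rfl hl
  | [a] => simp [intSine, continuant, continuantMatrix]
  | [a, b] => simp [intSine, continuant, continuantMatrix]
  | a :: b :: c :: t =>
    rw [continuantMatrix_cons_zero, continuantMatrix_cons_one,
      ← intSine_eq_continuantMatrix (List.cons_ne_nil b (c :: t)),
      ← intSine_eq_continuantMatrix (List.cons_ne_nil c t)]
    simp [intSine, continuant]
termination_by l.length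

/-- The Cayley–Hamilton identity for `2 × 2` matrices, multiplied on the right by `B`. -/
theorem Matrix.mul_mul_eq_trace_smul_sub_det_smul {R : Type*} [CommRing R]
    (A B : Matrix (Fin 2) (Fin 2) R) :
    A * (A * B) = A.trace • (A * B) - A.det • B := by
  ext i j
  fin_cases i <;>
    simp [Matrix.mul_apply, Matrix.trace_fin_two, Matrix.det_fin_two] <;> ring

/-- The Cayley–Hamilton identity for `2 × 2` matrices, multiplied on the left by `A`. -/
theorem Matrix.mul_mul_eq_trace_smul_sub_det_smul' {R : Type*} [CommRing R]
    (A B : Matrix (Fin 2) (Fin 2) R) :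
    A * B * B = B.trace • (A * B) - B.det • A := by
  ext i j
  fin_cases j <;>
    simp [Matrix.mul_apply, Matrix.trace_fin_two, Matrix.det_fin_two] <;> ring

/-- A nonempty sequence whose continuant matrix has determinant `1` and trace equal to three times
its upper right entry. -/
structure IsMarkovSeq (l : List ℤ) : Prop where
  ne_nil : l ≠ []
  det_eq : (continuantMatrix l).det = 1
  trace_eq : (continuantMatrix l).trace = 3 * continuantMatrix l 0 1

namespace IsMarkovSeq

variable {l m : List ℤ}

theorem continuantMatrix_left (hl : IsMarkovSeq l) (m : List ℤ) :
    continuantMatrix (l ++ (l ++ m)) =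
      (3 * continuantMatrix l 0 1) • continuantMatrix (l ++ m) - continuantMatrix m := by
  simp only [continuantMatrix_append]
  rw [Matrix.mul_mul_eq_trace_smul_sub_det_smul, hl.det_eq, hl.trace_eq, one_smul]

theorem continuantMatrix_right (hm : IsMarkovSeq m) (l : List ℤ) :
    continuantMatrix (l ++ m ++ m) =
      (3 * continuantMatrix m 0 1) • continuantMatrix (l ++ m) - continuantMatrix l := by
  simp only [continuantMatrix_append]
  rw [Matrix.mul_mul_eq_trace_smul_sub_det_smul', hm.det_eq, hm.trace_eq, one_smul]

theorem append_left (hl : IsMarkovSeq l) (hm : IsMarkovSeq m) (hlm : IsMarkovSeq (l ++ m)) :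
    IsMarkovSeq (l ++ (l ++ m)) where
  ne_nil := by simp [hl.ne_nil]
  det_eq := by rw [continuantMatrix_append, Matrix.det_mul, hl.det_eq, hlm.det_eq, one_mul]
  trace_eq := by
    simp only [hl.continuantMatrix_left, Matrix.trace_sub, Matrix.trace_smul, Matrix.sub_apply,
      Matrix.smul_apply, smul_eq_mul, hlm.trace_eq, hm.trace_eq]
    ring

theorem append_right (hl : IsMarkovSeq l) (hm : IsMarkovSeq m) (hlm : IsMarkovSeq (l ++ m)) :
    IsMarkovSeq (l ++ m ++ m) where
  ne_nil := by simp [hl.ne_nil]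
  det_eq := by rw [continuantMatrix_append, Matrix.det_mul, hm.det_eq, hlm.det_eq, one_mul]
  trace_eq := by
    simp only [hm.continuantMatrix_right, Matrix.trace_sub, Matrix.trace_smul, Matrix.sub_apply,
      Matrix.smul_apply, smul_eq_mul, hlm.trace_eq, hl.trace_eq]
    ring

end IsMarkovSeq

theorem Reach.isMarkovSeq {v : Triple} (hv : Reach markovRoot v) :
    v.2.1 = v.1 ++ v.2.2 ∧ IsMarkovSeq v.1 ∧ IsMarkovSeq v.2.2 ∧ IsMarkovSeq (v.1 ++ v.2.2) := by
  induction hv with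
  | refl =>
    refine ⟨rfl, ?_, ?_, ?_⟩ <;> constructor <;>
      simp [markovRoot, continuantMatrix, Matrix.det_fin_two, Matrix.trace_fin_two]
  | @tail u w _ step ih =>
    obtain ⟨α, γ, β⟩ := u
    obtain ⟨hγ_eq, hα, hβ, hγ⟩ := ih
    dsimp only at hγ_eq hα hβ hγ
    subst hγ_eq
    rcases step with rfl | rfl
    · exact ⟨rfl, hα, hγ, hα.append_left hβ hγ⟩
    · exact ⟨rfl, hγ, hβ, hα.append_right hβ hγ⟩

/-- The edges of the graph of regular Markov numbers obey the Markov recurrences: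
if `(x, M, y) = χ(v)` for a reachable vertex `v`, then
`χ(L v) = (x, 3Mx − y, M)` and `χ(R v) = (M, 3My − x, y)`. -/
theorem markov_edge_recurrence (v : Triple) (hv : Reach markovRoot v) :
    chi (Lmove v) = ((chi v).1, 3 * (chi v).2.1 * (chi v).1 - (chi v).2.2, (chi v).2.1) ∧
    chi (Rmove v) = ((chi v).2.1, 3 * (chi v).2.1 * (chi v).2.2 - (chi v).1, (chi v).2.2) := by
  obtain ⟨α, γ, β⟩ := v
  obtain ⟨hγ_eq, hα, hβ, hγ⟩ := hv.isMarkovSeq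
  dsimp only at hγ_eq hα hβ hγ
  subst hγ_eq
  simp only [chi, Lmove, Rmove, Prod.mk.injEq, true_and, and_true]
  rw [intSine_eq_continuantMatrix (hα.append_left hβ hγ).ne_nil,
    intSine_eq_continuantMatrix (hα.append_right hβ hγ).ne_nil,
    intSine_eq_continuantMatrix hα.ne_nil, intSine_eq_continuantMatrix hβ.ne_nil,
    intSine_eq_continuantMatrix hγ.ne_nil, hα.continuantMatrix_left, hβ.continuantMatrix_right]
  simp only [Matrix.sub_apply, Matrix.smul_apply, smul_eq_mul]
  constructor <;> ring
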